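/- arXiv:1012.0957 — 2 statements merged into one kernel-verified Lean document; each statement's English description precedes it below -/
import Mathlib

section
/- Let p ∈ ℂ[s] be a polynomial of degree N_p with leading coefficient p_{N_p} ≠ 0, and let N_q ∈ ℕ be such that p and s^{N_q} are coprime (i.e. N_q = 0 or p(0) ≠ 0) and N_p = N_q + 2. Let n ≥ 1 and let J_n ∈ Mₙ(ℂ) be the nilpotent Jordan block. Then there exists S ∈ Mₙ(ℂ)((x)), invertible in Mₙ(ℂ)((x)), with every coefficient lying in the unital subalgebra ℂ[J_n] of Mₙ(ℂ), satisfying S^{N_q}·(dS/dx) = p(S), such that the image of S under the coefficientwise application of the ℂ-algebra homomorphism ℂ[J_n] → ℂ sending J_n to 0 is a Laurent series of order −1 with leading coefficient −1/p_{N_p}, and such that the unital subalgebra of Mₙ(ℂ) generated by the coefficients of S is all of ℂ[J_n]. -/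
/-- Formal derivative of a Laurent series. -/
noncomputable def lsDeriv {A : Type*} [Ring A] (f : LaurentSeries A) : LaurentSeries A where
  coeff k := (k + 1) • f.coeff (k + 1)
  isPWO_support' := by
    refine (f.isPWO_support.image_of_monotone
      (f := fun m : ℤ => m - 1) (fun a b h => by simpa using h)).mono ?_
    intro k hk
    have hk' : f.coeff (k + 1) ≠ 0 := by
      intro h
      simp [Function.mem_support, h] at hk
    exact ⟨k + 1, hk', by ring⟩

/-- The `n × n` nilpotent Jordan block `Jₙ` (ones on the superdiagonal). -/
def jordanBlock (n : ℕ) : Matrix (Fin n) (Fin n) ℂ :=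
  Matrix.of fun i j => if (i : ℕ) + 1 = (j : ℕ) then 1 else 0

namespace StmtNine

open PowerSeries

/-! ### The derivation on Laurent series -/

theorem lsDeriv_coeff {A : Type*} [Ring A] (f : LaurentSeries A) (k : ℤ) :
    (lsDeriv f).coeff k = (k + 1) • f.coeff (k + 1) := rfl

theorem lsDeriv_add {A : Type*} [Ring A] (f g : LaurentSeries A) :
    lsDeriv (f + g) = lsDeriv f + lsDeriv g := by
  ext k
  simp only [lsDeriv_coeff, HahnSeries.coeff_add, smul_add]

/-- The derivative as an additive map. -/
noncomputable def dHom (A : Type*) [Ring A] : LaurentSeries A →+ LaurentSeries A :=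
  AddMonoidHom.mk' lsDeriv lsDeriv_add

/-- The Euler operator `x d/dx`. -/
noncomputable def theta (f : LaurentSeries ℂ) : LaurentSeries ℂ where
  coeff k := k • f.coeff k
  isPWO_support' := by
    refine f.isPWO_support.mono ?_
    intro k hk h
    apply hk
    change k • f.coeff k = 0
    rw [h, smul_zero]

theorem theta_mul (f g : LaurentSeries ℂ) : theta (f * g) = theta f * g + f * theta g := by
  have hs : ∀ f : LaurentSeries ℂ, (theta f).support ⊆ f.support := by
    intro f k hk h
    apply hk
    change k • f.coeff k = 0
    rw [h, smul_zero]
  ext k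
  rw [HahnSeries.coeff_add, HahnSeries.coeff_mul_left' f.isPWO_support (hs f),
    HahnSeries.coeff_mul_right' g.isPWO_support (hs g)]
  change k • (f * g).coeff k = _
  rw [HahnSeries.coeff_mul, Finset.smul_sum, ← Finset.sum_add_distrib]
  refine Finset.sum_congr rfl fun ij hij => ?_
  obtain ⟨_, _, h⟩ := Finset.mem_antidiagonal.mp hij
  change _ = (ij.1 • f.coeff ij.1) * _ + _ * (ij.2 • g.coeff ij.2)
  rw [← h]
  simp only [zsmul_eq_mul]
  push_cast
  ring

theorem lsDeriv_eq (f : LaurentSeries ℂ) :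
    lsDeriv f = HahnSeries.single (-1 : ℤ) (1 : ℂ) * theta f := by
  ext k
  rw [HahnSeries.coeff_single_mul, one_mul, sub_neg_eq_add]
  rfl

theorem lsDeriv_mul (f g : LaurentSeries ℂ) :
    lsDeriv (f * g) = lsDeriv f * g + f * lsDeriv g := by
  simp only [lsDeriv_eq, theta_mul]
  ring

theorem lsDeriv_C {A : Type*} [Ring A] (z : A) :
    lsDeriv (HahnSeries.C z : LaurentSeries A) = 0 := by
  ext k
  rw [lsDeriv_coeff, HahnSeries.C_apply, HahnSeries.coeff_single]
  split_ifs with h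
  · simp [h]
  · simp

/-! ### The Taylor homomorphism -/

/-- `f(x+t)` as a power series in `t`. -/
noncomputable def taylor (f : LaurentSeries ℂ) : PowerSeries (LaurentSeries ℂ) :=
  PowerSeries.mk fun k => HahnSeries.C ((k.factorial : ℂ)⁻¹) * (lsDeriv^[k] f)

theorem iter_add (k : ℕ) (f g : LaurentSeries ℂ) :
    lsDeriv^[k] (f + g) = lsDeriv^[k] f + lsDeriv^[k] g := by
  induction k generalizing f g with
  | zero => rfl
  | succ k ih => simp only [Function.iterate_succ_apply, lsDeriv_add, ih]

theorem taylor_add (f g : LaurentSeries ℂ) : taylor (f + g) = taylor f + taylor g := by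
  ext k : 1
  simp only [taylor, coeff_mk, map_add, iter_add, mul_add]

theorem taylor_coeff_succ (f : LaurentSeries ℂ) (k : ℕ) :
    coeff (k + 1) (taylor f) * ((k : LaurentSeries ℂ) + 1) = coeff k (taylor (lsDeriv f)) := by
  simp only [taylor, coeff_mk, Function.iterate_succ_apply]
  have h1 : (((k + 1).factorial : ℂ)⁻¹) * ((k : ℂ) + 1) = (k.factorial : ℂ)⁻¹ := by
    have : (k.factorial : ℂ) ≠ 0 := by exact_mod_cast k.factorial_ne_zero
    have : (k : ℂ) + 1 ≠ 0 := by exact_mod_cast k.succ_ne_zero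
    rw [Nat.factorial_succ]
    push_cast
    field_simp
  rw [← h1, map_mul, map_add, map_natCast, map_one]
  ring

theorem taylor_deriv (f : LaurentSeries ℂ) :
    PowerSeries.derivative (LaurentSeries ℂ) (taylor f) = taylor (lsDeriv f) := by
  ext k : 1
  rw [PowerSeries.coeff_derivative, taylor_coeff_succ]

theorem taylor_mul (f g : LaurentSeries ℂ) : taylor (f * g) = taylor f * taylor g := by
  ext k : 1
  induction k generalizing f g with
  | zero => simp [taylor, coeff_mul]
  | succ k ih =>
    have hk : (k : LaurentSeries ℂ) + 1 ≠ 0 := by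
      have : ((k : ℂ) + 1) ≠ 0 := by exact_mod_cast k.succ_ne_zero
      intro h
      apply this
      have h2 := congrArg (fun s => HahnSeries.coeff s 0) h
      have h3 : ((k : LaurentSeries ℂ) + 1) = HahnSeries.C ((k : ℂ) + 1) := by
        rw [map_add, map_natCast, map_one]
      simpa [h3, HahnSeries.C_apply] using h2
    apply mul_right_cancel₀ hk
    rw [taylor_coeff_succ, lsDeriv_mul, taylor_add, map_add, ih, ih, ← taylor_deriv,
      ← taylor_deriv, ← PowerSeries.coeff_derivative, Derivation.leibniz, map_add,
      smul_eq_mul, smul_eq_mul, mul_comm (taylor g), add_comm]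

theorem iter_C (k : ℕ) (z : ℂ) :
    lsDeriv^[k + 1] (HahnSeries.C z : LaurentSeries ℂ) = 0 := by
  rw [Function.iterate_succ_apply, lsDeriv_C]
  exact Function.iterate_fixed (by simpa using lsDeriv_C (0 : ℂ)) k

theorem taylor_C (z : ℂ) : taylor (HahnSeries.C z) = PowerSeries.C (HahnSeries.C z) := by
  ext k : 1
  cases k with
  | zero => simp [taylor]
  | succ k =>
    rw [taylor, coeff_mk, iter_C, mul_zero, PowerSeries.coeff_C, if_neg k.succ_ne_zero]

/-! ### The scalar ODE -/

theorem exists_power_solution (r : Polynomial ℂ) : ∃ f : PowerSeries ℂ,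
    constantCoeff f = 0 ∧ ∀ k, coeff (k + 1) f * ((k : ℂ) + 1) =
      coeff k (Polynomial.eval₂ (PowerSeries.C (R := ℂ)) f r) := by
  let P : PowerSeries ℂ → PowerSeries ℂ := fun f => PowerSeries.mk fun k =>
    match k with
    | 0 => 0
    | k + 1 => coeff k (Polynomial.eval₂ (PowerSeries.C (R := ℂ)) f r) / ((k : ℂ) + 1)
  have hev : ∀ (m : ℕ) (f g : PowerSeries ℂ), (∀ k < m, coeff k f = coeff k g) →
      ∀ k < m, coeff k (Polynomial.eval₂ (PowerSeries.C (R := ℂ)) f r)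
        = coeff k (Polynomial.eval₂ (PowerSeries.C (R := ℂ)) g r) := by
    intro m f g h
    have h1 : (X : PowerSeries ℂ) ^ m ∣ f - g := by
      rw [PowerSeries.X_pow_dvd_iff]
      intro k hk
      rw [map_sub, h k hk, sub_self]
    have h2 := h1.trans (Polynomial.sub_dvd_eval_sub f g (r.map (PowerSeries.C (R := ℂ))))
    rw [PowerSeries.X_pow_dvd_iff] at h2
    intro k hk
    have := h2 k hk
    rw [map_sub, sub_eq_zero] at this
    simpa only [Polynomial.eval_map] using this
  let F : ℕ → PowerSeries ℂ := fun m => P^[m] 0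
  have hF : ∀ m, F (m + 1) = P (F m) := fun m => Function.iterate_succ_apply' P m 0
  have hP : ∀ (m : ℕ) (f g : PowerSeries ℂ), (∀ k < m, coeff k f = coeff k g) →
      ∀ k < m + 1, coeff k (P f) = coeff k (P g) := by
    intro m f g h k hk
    cases k with
    | zero => simp [P]
    | succ k => simp only [P, coeff_mk]; rw [hev m f g h k (by omega)]
  have hst : ∀ m, ∀ k < m, coeff k (F m) = coeff k (F (m + 1)) := by
    intro m
    induction m with
    | zero => intro k hk; omega
    | succ m ih =>
      rw [hF (m + 1)]
      nth_rewrite 1 [hF m]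
      exact hP m _ _ ih
  have hst2 : ∀ k d, coeff k (F (k + 1)) = coeff k (F (k + 1 + d)) := by
    intro k d
    induction d with
    | zero => rfl
    | succ d ih => rw [ih, ← add_assoc, ← hst _ k (by omega)]
  let f : PowerSeries ℂ := PowerSeries.mk fun k => coeff k (F (k + 1))
  have hf : ∀ m, ∀ k < m, coeff k f = coeff k (F m) := by
    intro m k hk
    obtain ⟨d, rfl⟩ := Nat.exists_eq_add_of_le (Nat.succ_le_of_lt hk)
    simp only [f, coeff_mk]
    exact hst2 k d
  refine ⟨f, ?_, ?_⟩
  · rw [← coeff_zero_eq_constantCoeff_apply, hf 1 0 (by omega), hF]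
    simp [P]
  · intro k
    have hk : (k : ℂ) + 1 ≠ 0 := by exact_mod_cast k.succ_ne_zero
    rw [hf (k + 2) (k + 1) (by omega), hF, hev (k + 1) f (F (k + 1)) (hf (k + 1)) k (by omega)]
    simp only [P, coeff_mk]
    field_simp

theorem lsDeriv_coe (f : PowerSeries ℂ) :
    lsDeriv (f : LaurentSeries ℂ) = ((PowerSeries.derivative ℂ f : PowerSeries ℂ) : LaurentSeries ℂ) := by
  ext k
  rw [lsDeriv_coeff]
  rw [PowerSeries.coeff_coe, PowerSeries.coeff_coe]
  by_cases h : k < 0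
  · rw [if_pos h]
    by_cases h1 : k + 1 < 0
    · rw [if_pos h1, smul_zero]
    · have : k + 1 = 0 := by omega
      rw [this, zero_smul]
  · rw [if_neg h, if_neg (by omega)]
    obtain ⟨m, rfl⟩ := Int.eq_ofNat_of_zero_le (not_lt.mp h)
    rw [PowerSeries.coeff_derivative]
    have : ((m : ℤ) + 1).natAbs = m + 1 := by omega
    rw [this, Int.natAbs_natCast]
    simp [mul_comm]

theorem exists_scalar_solution (p : Polynomial ℂ) (hp : p ≠ 0) (N_q : ℕ)
    (hdeg : p.natDegree = N_q + 2) :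
    ∃ g : LaurentSeries ℂ, g ≠ 0 ∧ g.order = -1 ∧ g.coeff (-1) = -(p.leadingCoeff)⁻¹ ∧
      g.coeff (-2) = 0 ∧
      g ^ N_q * lsDeriv g = Polynomial.eval₂ (HahnSeries.C (Γ := ℤ) (R := ℂ)) g p := by
  obtain ⟨f, hf0, hf⟩ := exists_power_solution (-p.reverse)
  have hlc : p.leadingCoeff ≠ 0 := Polynomial.leadingCoeff_ne_zero.mpr hp
  obtain ⟨u, rfl⟩ := PowerSeries.X_dvd_iff.mpr hf0
  have hu : constantCoeff u = -p.leadingCoeff := by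
    have := hf 0
    rw [Nat.cast_zero, zero_add, zero_add, mul_one, coeff_zero_eq_constantCoeff_apply,
      Polynomial.hom_eval₂] at this
    rw [← coeff_zero_eq_constantCoeff_apply, ← coeff_succ_X_mul, zero_add, this]
    have h2 : (constantCoeff (R := ℂ)).comp PowerSeries.C = RingHom.id ℂ := by ext z; simp
    rw [h2, hf0, Polynomial.eval₂_id, ← Polynomial.coeff_zero_eq_eval_zero]
    simp
  have hu0 : constantCoeff u ≠ 0 := by rw [hu]; exact neg_ne_zero.mpr hlc
  have huv : u * u⁻¹ = 1 := PowerSeries.mul_inv_cancel u hu0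
  set v := u⁻¹ with hv
  have hv0 : coeff 0 v = -(p.leadingCoeff)⁻¹ := by
    rw [coeff_zero_eq_constantCoeff_apply, hv, constantCoeff_inv, hu, inv_neg]
  let F : LaurentSeries ℂ := ((X * u : PowerSeries ℂ) : LaurentSeries ℂ)
  let g : LaurentSeries ℂ := HahnSeries.single (-1 : ℤ) (1 : ℂ) * (v : LaurentSeries ℂ)
  have hFg : F * g = 1 := by
    have : F * g = (HahnSeries.single (1 : ℤ) (1 : ℂ) * HahnSeries.single (-1 : ℤ) (1 : ℂ)) *
        ((u * v : PowerSeries ℂ) : LaurentSeries ℂ) := by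
      simp only [F, g, map_mul, HahnSeries.ofPowerSeries_X]
      ring
    rw [this, huv, HahnSeries.single_mul_single]
    simp
  have hgc : ∀ k : ℤ, g.coeff k = if k + 1 < 0 then 0 else coeff (k + 1).natAbs v := by
    intro k
    rw [← PowerSeries.coeff_coe]
    simp only [g]
    rw [HahnSeries.coeff_single_mul, one_mul, sub_neg_eq_add]
  have hg1 : g.coeff (-1) = -(p.leadingCoeff)⁻¹ := by
    rw [hgc]; simpa using hv0
  have hg0 : g ≠ 0 := right_ne_zero_of_mul_eq_one hFg
  have hne : g.coeff (-1) ≠ 0 := by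
    rw [hg1]; exact neg_ne_zero.mpr (inv_ne_zero hlc)
  refine ⟨g, hg0, ?_, hg1, ?_, ?_⟩
  · apply le_antisymm
    · exact HahnSeries.order_le_of_coeff_ne_zero hne
    · by_contra h
      have h3 : g.coeff g.order ≠ 0 := by
        simpa using HahnSeries.coeff_order_eq_zero.not.mpr hg0
      apply h3
      rw [hgc, if_pos (by omega)]
  · rw [hgc, if_pos (by omega)]
  · have hDF : lsDeriv F = -Polynomial.eval₂ (HahnSeries.C (Γ := ℤ) (R := ℂ)) F p.reverse := by
      have h1 : PowerSeries.derivative ℂ (X * u) =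
          Polynomial.eval₂ (PowerSeries.C (R := ℂ)) (X * u) (-p.reverse) := by
        ext k
        rw [PowerSeries.coeff_derivative, hf]
      simp only [F]
      rw [lsDeriv_coe, h1, Polynomial.eval₂_neg, map_neg, Polynomial.hom_eval₂]
      congr 2
      ext z
      simp [HahnSeries.ofPowerSeries_C]
    let _ : Invertible g := ⟨F, hFg, by rw [mul_comm]; exact hFg⟩
    have hrev := Polynomial.eval₂_reverse_mul_pow (HahnSeries.C (Γ := ℤ) (R := ℂ)) g p
    change Polynomial.eval₂ _ F _ * _ = _ at hrev
    have hD : lsDeriv g = - (lsDeriv F * g ^ 2) := by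
      have h0 : lsDeriv F * g + F * lsDeriv g = 0 := by
        rw [← lsDeriv_mul, hFg]
        simpa using lsDeriv_C (1 : ℂ)
      linear_combination g * h0 - lsDeriv g * hFg
    rw [← hrev, hD, hDF, hdeg]
    ring

/-! ### Evaluating at the Jordan block -/

theorem jordan_pow (n k : ℕ) (i j : Fin n) :
    (jordanBlock n ^ k) i j = if (i : ℕ) + k = (j : ℕ) then 1 else 0 := by
  induction k generalizing i j with
  | zero => simp [Matrix.one_apply, Fin.ext_iff]
  | succ k ih =>
    rw [pow_succ', Matrix.mul_apply]
    simp only [ih]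
    simp only [jordanBlock, Matrix.of_apply]
    by_cases h : (i : ℕ) + 1 < n
    · rw [Finset.sum_eq_single ⟨(i : ℕ) + 1, h⟩]
      · simp [add_assoc, add_comm 1 k]
      · intro b _ hb
        rw [if_neg, zero_mul]
        intro h2
        exact hb (Fin.ext h2.symm)
      · simp
    · rw [if_neg (by omega)]
      apply Finset.sum_eq_zero
      intro b _
      rw [if_neg (by omega), zero_mul]

theorem jordan_pow_eq_zero (n k : ℕ) (h : n ≤ k) : jordanBlock n ^ k = 0 := by
  ext i j
  rw [jordan_pow, if_neg (by omega)]
  rfl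

/-- Scalar Laurent series as matrix Laurent series. -/
noncomputable def scal (n : ℕ) :
    LaurentSeries ℂ →+* LaurentSeries (Matrix (Fin n) (Fin n) ℂ) where
  toFun f := f.map (algebraMap ℂ (Matrix (Fin n) (Fin n) ℂ))
  map_one' := by
    ext1; funext k
    simp only [HahnSeries.map_coeff, HahnSeries.coeff_one]
    split_ifs <;> simp
  map_zero' := by
    ext1; funext k
    simp
  map_add' f g := by
    ext1; funext k
    simp
  map_mul' f g := by
    have hs : ∀ f : LaurentSeries ℂ,
        (f.map (algebraMap ℂ (Matrix (Fin n) (Fin n) ℂ))).support ⊆ f.support := by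
      intro f k hk h
      apply hk
      rw [HahnSeries.map_coeff, h, map_zero]
    have key : ∀ k, ((f.map (algebraMap ℂ (Matrix (Fin n) (Fin n) ℂ))) *
      (g.map (algebraMap ℂ (Matrix (Fin n) (Fin n) ℂ)))).coeff k =
       ∑ ij ∈ Finset.antidiagonal f.isPWO_support g.isPWO_support k,
        algebraMap ℂ (Matrix (Fin n) (Fin n) ℂ) (f.coeff ij.1) *
        algebraMap ℂ (Matrix (Fin n) (Fin n) ℂ) (g.coeff ij.2) := by
      intro k
      rw [HahnSeries.coeff_mul]
      refine Finset.sum_subset_zero_on_sdiff ?_ ?_ ?_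
      · intro ij hij
        obtain ⟨h1, h2, h3⟩ := Finset.mem_antidiagonal.mp hij
        exact Finset.mem_antidiagonal.mpr ⟨hs f h1, hs g h2, h3⟩
      · intro ij hij
        obtain ⟨hij1, hij2⟩ := Finset.mem_sdiff.mp hij
        obtain ⟨h1, h2, h3⟩ := Finset.mem_antidiagonal.mp hij1
        by_contra hne
        apply hij2
        refine Finset.mem_antidiagonal.mpr ⟨?_, ?_, h3⟩
        · exact left_ne_zero_of_mul hne
        · exact right_ne_zero_of_mul hne
      · intro ij _
        rfl
    ext1; funext k
    rw [key, HahnSeries.map_coeff, HahnSeries.coeff_mul, map_sum]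
    simp only [map_mul]

theorem scal_mul_C_coeff (n : ℕ) (f : LaurentSeries ℂ) (M : Matrix (Fin n) (Fin n) ℂ) (k : ℤ) :
    (scal n f * HahnSeries.C M).coeff k = f.coeff k • M := by
  rw [HahnSeries.C_apply, HahnSeries.coeff_mul_single_zero]
  change algebraMap ℂ (Matrix (Fin n) (Fin n) ℂ) (f.coeff k) * M = _
  rw [Algebra.smul_def]

theorem scal_commute (n : ℕ) (f : LaurentSeries ℂ) (M : Matrix (Fin n) (Fin n) ℂ) :
    Commute (scal n f) (HahnSeries.C M) := by
  change _ = _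
  ext1; funext k
  rw [HahnSeries.C_apply, HahnSeries.coeff_mul_single_zero, HahnSeries.coeff_single_zero_mul]
  exact Algebra.commutes _ _

/-- Evaluation of polynomials over Laurent series at the Jordan block. -/
noncomputable def evJ (n : ℕ) :
    Polynomial (LaurentSeries ℂ) →+* LaurentSeries (Matrix (Fin n) (Fin n) ℂ) :=
  Polynomial.eval₂RingHom' (scal n) (HahnSeries.C (jordanBlock n))
    (fun f => scal_commute n f _)

theorem evJ_apply (n : ℕ) (P : Polynomial (LaurentSeries ℂ)) :
    evJ n P = P.eval₂ (scal n) (HahnSeries.C (jordanBlock n)) := rfl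

theorem evJ_trunc (n : ℕ) (P : Polynomial (LaurentSeries ℂ)) :
    evJ n (trunc (n + 1) (P : PowerSeries (LaurentSeries ℂ))) = evJ n P := by
  rw [evJ_apply, evJ_apply, PowerSeries.eval₂_trunc_eq_sum_range,
    Polynomial.eval₂_eq_sum_range' (n := n + 1 + P.natDegree) _ (by omega),
    Finset.sum_range_add _ (n + 1) P.natDegree]
  · simp only [Polynomial.coeff_coe, left_eq_add]
    apply Finset.sum_eq_zero
    intro k _
    rw [← map_pow, jordan_pow_eq_zero _ _ (by omega), map_zero, mul_zero]

/-- `f ↦ f(x + Jₙ)`. -/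
noncomputable def shift (n : ℕ) :
    LaurentSeries ℂ →+* LaurentSeries (Matrix (Fin n) (Fin n) ℂ) where
  toFun f := evJ n (trunc (n + 1) (taylor f))
  map_one' := by
    have : taylor 1 = 1 := by simpa using taylor_C 1
    rw [this, trunc_one, map_one]
  map_zero' := by
    have : taylor 0 = 0 := by simpa using taylor_C 0
    rw [this, map_zero, map_zero]
  map_add' f g := by rw [taylor_add, map_add, map_add]
  map_mul' f g := by
    rw [taylor_mul, ← trunc_trunc_mul_trunc, ← Polynomial.coe_mul, evJ_trunc, map_mul]

theorem shift_eq (n : ℕ) (f : LaurentSeries ℂ) : shift n f =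
    ∑ k ∈ Finset.range (n + 1), scal n (HahnSeries.C ((k.factorial : ℂ)⁻¹) * (lsDeriv^[k] f)) *
      HahnSeries.C (jordanBlock n ^ k) := by
  change evJ n (trunc (n + 1) (taylor f)) = _
  rw [evJ_apply, PowerSeries.eval₂_trunc_eq_sum_range]
  simp only [taylor, coeff_mk, map_pow]

theorem shift_coeff (n : ℕ) (f : LaurentSeries ℂ) (m : ℤ) : (shift n f).coeff m =
    ∑ k ∈ Finset.range (n + 1), ((k.factorial : ℂ)⁻¹ * (lsDeriv^[k] f).coeff m) •
      jordanBlock n ^ k := by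
  rw [shift_eq, HahnSeries.coeff_sum]
  refine Finset.sum_congr rfl fun k _ => ?_
  rw [scal_mul_C_coeff, HahnSeries.C_apply, HahnSeries.coeff_single_zero_mul]

theorem shift_deriv (n : ℕ) (f : LaurentSeries ℂ) :
    lsDeriv (shift n f) = shift n (lsDeriv f) := by
  ext1; funext m
  rw [lsDeriv_coeff, shift_coeff, shift_coeff, Finset.smul_sum]
  refine Finset.sum_congr rfl fun k _ => ?_
  rw [← Function.iterate_succ_apply, Function.iterate_succ_apply', lsDeriv_coeff, ← smul_assoc]
  congr 1
  simp only [zsmul_eq_mul]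
  ring

theorem shift_C (n : ℕ) (z : ℂ) : shift n (HahnSeries.C z) =
    algebraMap ℂ (LaurentSeries (Matrix (Fin n) (Fin n) ℂ)) z := by
  change evJ n (trunc (n + 1) (taylor _)) = _
  rw [taylor_C, trunc_C, evJ_apply, Polynomial.eval₂_C, HahnSeries.algebraMap_apply]
  ext1; funext k
  change algebraMap ℂ (Matrix (Fin n) (Fin n) ℂ) ((HahnSeries.C z : LaurentSeries ℂ).coeff k) = _
  rw [HahnSeries.C_apply, HahnSeries.C_apply, HahnSeries.coeff_single, HahnSeries.coeff_single]
  split_ifs <;> simp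

end StmtNine

/-- Let `p ∈ ℂ[s]` be nonzero of degree `N_p = N_q + 2` with leading
coefficient `p_{N_p} ≠ 0`, `p, s^{N_q}` coprime, and `n ≥ 1`.  Then there is an
invertible `S ∈ Mₙ(ℂ)((x))` with every coefficient in `ℂ[Jₙ]`, satisfying
`S^{N_q}·(dS/dx) = p(S)`, whose scalar (semisimple) part — the image of `S` under the
coefficientwise homomorphism `ℂ[Jₙ] → ℂ`, `Jₙ ↦ 0`, i.e. the scalar Laurent series `g`
with all coefficients of `S − g·1ₙ` nilpotent — has order `−1` and leading coefficient
`−1/p_{N_p}`, and such that the coefficients of `S` generate all of `ℂ[Jₙ]`. -/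
theorem stmt_9 (n : ℕ) (hn : 0 < n) (p : Polynomial ℂ) (hp : p ≠ 0) (N_q : ℕ)
    (hco : N_q = 0 ∨ p.coeff 0 ≠ 0) (hdeg : p.natDegree = N_q + 2) :
    ∃ S : LaurentSeries (Matrix (Fin n) (Fin n) ℂ),
      IsUnit S ∧
      (∀ k : ℤ, S.coeff k ∈
        Algebra.adjoin ℂ ({jordanBlock n} : Set (Matrix (Fin n) (Fin n) ℂ))) ∧
      S ^ N_q * lsDeriv S = Polynomial.aeval S p ∧
      (∃ g : LaurentSeries ℂ, g ≠ 0 ∧ g.order = -1 ∧ g.coeff (-1) = -(p.leadingCoeff)⁻¹ ∧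
        ∀ k : ℤ, IsNilpotent (S.coeff k - g.coeff k • (1 : Matrix (Fin n) (Fin n) ℂ))) ∧
      Algebra.adjoin ℂ (Set.range fun k : ℤ => S.coeff k) =
        Algebra.adjoin ℂ ({jordanBlock n} : Set (Matrix (Fin n) (Fin n) ℂ)) := by
  obtain ⟨g, hg0, hgo, hg1, hg2, hg⟩ := StmtNine.exists_scalar_solution p hp N_q hdeg
  have hmem : ∀ k : ℤ, (StmtNine.shift n g).coeff k ∈
        Algebra.adjoin ℂ ({jordanBlock n} : Set (Matrix (Fin n) (Fin n) ℂ)) := by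
    intro k
    rw [StmtNine.shift_coeff]
    refine Subalgebra.sum_mem _ fun m _ => Subalgebra.smul_mem _ (Subalgebra.pow_mem _ ?_ _) _
    exact Algebra.subset_adjoin rfl
  have hJ : (StmtNine.shift n g).coeff (-2) = (p.leadingCoeff)⁻¹ • jordanBlock n := by
    rw [StmtNine.shift_coeff, Finset.sum_eq_single 1]
    · rw [Function.iterate_one, StmtNine.lsDeriv_coeff]
      norm_num [hg1]
    · intro b _ hb
      rcases b with _ | _ | b
      · simp [hg2]
      · exact absurd rfl hb
      · rw [Function.iterate_succ_apply', StmtNine.lsDeriv_coeff, Function.iterate_succ_apply',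
          StmtNine.lsDeriv_coeff]
        norm_num
    · intro h
      exact absurd (Finset.mem_range.mpr (by omega)) h
  refine ⟨StmtNine.shift n g, (IsUnit.mk0 g hg0).map (StmtNine.shift n), hmem, ?_,
    ⟨g, hg0, hgo, hg1, ?_⟩, ?_⟩
  · rw [StmtNine.shift_deriv, ← map_pow, ← map_mul, hg, Polynomial.hom_eval₂,
      Polynomial.aeval_def]
    congr 1
    ext1 z
    exact StmtNine.shift_C n z
  · intro k
    rw [StmtNine.shift_coeff, Finset.sum_range_succ']
    simp only [Nat.factorial_zero, Nat.cast_one, inv_one, one_mul, Function.iterate_zero, id,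
      pow_zero, add_sub_cancel_right, pow_succ, ← smul_mul_assoc]
    rw [← Finset.sum_mul]
    refine Commute.isNilpotent_mul_left ?_ ⟨n, StmtNine.jordan_pow_eq_zero n n le_rfl⟩
    refine Commute.sum_left _ _ _ fun m _ => ?_
    exact ((Commute.refl (jordanBlock n)).pow_left m).smul_left _
  · apply le_antisymm
    · rw [Algebra.adjoin_le_iff]
      rintro _ ⟨k, rfl⟩
      exact hmem k
    · rw [Algebra.adjoin_le_iff]
      rintro _ rfl
      have h := Subalgebra.smul_mem _ (Algebra.subset_adjoin (R := ℂ) (Set.mem_range_self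
        (f := fun k : ℤ => (StmtNine.shift n g).coeff k) (-2))) p.leadingCoeff
      simp only [hJ] at h
      rwa [smul_smul, mul_inv_cancel₀ (Polynomial.leadingCoeff_ne_zero.mpr hp), one_smul] at h
end

section
/- Let m, n ≥ 1. Let S ∈ Mₘ(ℂ)((x)) have pairwise commuting coefficients and suppose there is a nonzero f ∈ ℂ((x)) such that every coefficient of S − f·1ₘ is a nilpotent matrix. Let S(yⁿ) ∈ Mₘ(ℂ)((y)) denote the series obtained from S by substituting x = yⁿ (each coefficient a_k of x^k becomes the coefficient of y^{nk}). Then the set of T ∈ Mₘ(ℂ)((y)) such that (i) the coefficients of T pairwise commute, (ii) there exists g ∈ ℂ((y)) such that every coefficient of T − g·1ₘ is a nilpotent matrix, and (iii) Tⁿ = S(yⁿ), has exactly n elements. -/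
/-- Substitution `x = yⁿ` in a Laurent series: the coefficient of `y^(nk)` in
`lsExpand n S` is the coefficient of `x^k` in `S`, and all other coefficients
vanish. -/
noncomputable def lsExpand {A : Type*} [Ring A] (n : ℕ) (S : LaurentSeries A) :
    LaurentSeries A where
  coeff k := if k % (n : ℤ) = 0 then S.coeff (k / n) else 0
  isPWO_support' := by
    have hsub : (Function.support fun k : ℤ =>
        if k % (n : ℤ) = 0 then S.coeff (k / n) else 0)
        ⊆ ((fun m : ℤ => m * n) '' S.support) ∪ {0} := by
      intro k hk
      by_cases h0 : k % (n : ℤ) = 0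
      · simp only [Function.mem_support, h0, if_true] at hk
        by_cases hn0 : (n : ℤ) = 0
        · right
          simp only [Set.mem_singleton_iff]
          simpa [hn0] using h0
        · left
          exact ⟨k / n, hk, Int.ediv_mul_cancel (Int.dvd_of_emod_eq_zero h0)⟩
      · simp only [Function.mem_support, if_neg h0] at hk
        exact absurd rfl hk
    refine Set.IsPWO.mono ?_ hsub
    exact (S.isPWO_support.image_of_monotone fun a b h =>
      mul_le_mul_of_nonneg_right h (by positivity)).union (Set.finite_singleton 0).isPWO

open scoped LaurentSeries in
theorem aux_commute {A : Type*} [Ring A] (x y : LaurentSeries A)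
    (h : ∀ i j, Commute (x.coeff i) (y.coeff j)) : Commute x y := by
  show x * y = y * x
  ext k
  rw [HahnSeries.coeff_mul, HahnSeries.coeff_mul]
  refine Finset.sum_nbij' Prod.swap Prod.swap ?_ ?_ ?_ ?_ ?_
  · rintro ⟨i, j⟩ hij
    simp only [Finset.mem_antidiagonal, Prod.swap] at hij ⊢
    exact ⟨hij.2.1, hij.1, by rw [add_comm]; exact hij.2.2⟩
  · rintro ⟨i, j⟩ hij
    simp only [Finset.mem_antidiagonal, Prod.swap] at hij ⊢
    exact ⟨hij.2.1, hij.1, by rw [add_comm]; exact hij.2.2⟩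
  · intros; simp
  · intros; simp
  · rintro ⟨i, j⟩ _
    exact h i j

/-- Laurent series mapping along a ring homomorphism. -/
noncomputable def auxMap {A B : Type*} [Ring A] [Ring B] (h : A →+* B) :
    LaurentSeries A →+* LaurentSeries B where
  toFun x := HahnSeries.map x h
  map_one' := HahnSeries.map_one (h.toMonoidWithZeroHom)
  map_mul' _ _ := HahnSeries.map_mul (h : A →ₙ+* B)
  map_zero' := by ext; simp
  map_add' _ _ := HahnSeries.map_add (h : A →+ B)

theorem auxMap_coeff {A B : Type*} [Ring A] [Ring B] (h : A →+* B) (x : LaurentSeries A) (k : ℤ) :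
    (auxMap h x).coeff k = h (x.coeff k) := rfl

theorem auxMap_injective {A B : Type*} [Ring A] [Ring B] (h : A →+* B)
    (hh : Function.Injective h) : Function.Injective (auxMap h) := by
  intro x y hxy
  ext k
  apply hh
  rw [← auxMap_coeff, ← auxMap_coeff, hxy]

theorem aux_nil_comm {B : Type*} [CommRing B] [IsNoetherianRing B] (x : LaurentSeries B)
    (h : ∀ k, IsNilpotent (x.coeff k)) : IsNilpotent x := by
  obtain ⟨N, hN⟩ := IsNoetherianRing.isNilpotent_nilradical B
  refine ⟨N, ?_⟩
  have key : ∀ r : ℕ, ∀ k, (x ^ r).coeff k ∈ (nilradical B) ^ r := by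
    intro r
    induction r with
    | zero => intro k; simp
    | succ r ih =>
      intro k
      rw [pow_succ, pow_succ, HahnSeries.coeff_mul]
      exact Ideal.sum_mem _ fun ij _ => Ideal.mul_mem_mul (ih _) (h _)
  ext k
  have := key N k
  rw [hN] at this
  simpa using this

theorem aux_nil {m : ℕ} (x : LaurentSeries (Matrix (Fin m) (Fin m) ℂ))
    (hc : ∀ i j, Commute (x.coeff i) (x.coeff j))
    (h : ∀ k, IsNilpotent (x.coeff k)) : IsNilpotent x := by
  set B := Algebra.adjoin ℂ (Set.range x.coeff) with hB
  letI : CommRing B := Algebra.adjoinCommRingOfComm ℂ (by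
    rintro _ ⟨i, rfl⟩ _ ⟨j, rfl⟩; exact hc i j)
  have : IsNoetherianRing B := isNoetherian_of_tower ℂ inferInstance
  let y : LaurentSeries B :=
    { coeff := fun k => ⟨x.coeff k, Algebra.subset_adjoin ⟨k, rfl⟩⟩
      isPWO_support' := x.isPWO_support.mono (by
        intro k hk
        simp only [Function.mem_support] at hk
        intro h0
        exact hk (Subtype.ext h0)) }
  have hy : auxMap (B.val : B →+* _) y = x := by
    ext k; rfl
  rw [← hy]
  refine IsNilpotent.map (aux_nil_comm (B := B) y ?_) _
  intro k
  obtain ⟨r, hr⟩ := h k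
  exact ⟨r, Subtype.ext hr⟩

theorem aux_root_exists {R : Type*} [Ring R] [Algebra ℂ R] (n : ℕ) (hn : 0 < n) (a : R)
    (ha : IsNilpotent (a - 1)) :
    ∃ w ∈ Algebra.adjoin ℂ {a}, IsNilpotent (w - 1) ∧ w ^ n = a := by
  set B := Algebra.adjoin ℂ ({a} : Set R) with hB
  let a' : B := ⟨a, Algebra.self_mem_adjoin_singleton ℂ a⟩
  let P : Polynomial B := Polynomial.X ^ n - Polynomial.C a'
  have h1 : IsNilpotent (Polynomial.aeval (1 : B) P) := by
    have : Polynomial.aeval (1 : B) P = -(a' - 1) := by simp [P]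
    rw [this, isNilpotent_neg_iff]
    obtain ⟨r, hr⟩ := ha
    exact ⟨r, Subtype.ext hr⟩
  have h2 : IsUnit (Polynomial.aeval (1 : B) (Polynomial.derivative P)) := by
    have : Polynomial.aeval (1 : B) (Polynomial.derivative P) = algebraMap ℂ B n := by
      simp [P, Polynomial.derivative_X_pow, -map_pow]
    rw [this]
    exact (IsUnit.mk0 (n : ℂ) (by exact_mod_cast hn.ne')).map _
  obtain ⟨w, ⟨hw1, hw2⟩, -⟩ := Polynomial.existsUnique_nilpotent_sub_and_aeval_eq_zero h1 h2
  refine ⟨w, w.2, ?_, ?_⟩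
  · have : IsNilpotent (w - 1) := by rw [← isNilpotent_neg_iff]; simpa using hw1
    exact IsNilpotent.map this B.val
  · have : w ^ n = a' := by simpa [P, sub_eq_zero] using hw2
    exact congrArg Subtype.val this

theorem aux_root_unique_comm {B : Type*} [CommRing B] [Algebra ℂ B] (n : ℕ) (hn : 0 < n)
    (u w : B) (hu : IsNilpotent (u - 1)) (hw : IsNilpotent (w - 1))
    (h : u ^ n = w ^ n) : u = w := by
  let P : Polynomial B := Polynomial.X ^ n - Polynomial.C (w ^ n)
  have h1 : IsNilpotent (Polynomial.aeval (1 : B) P) := by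
    have : Polynomial.aeval (1 : B) P = -(w ^ n - 1) := by simp [P]
    rw [this, isNilpotent_neg_iff]
    obtain ⟨c, hc⟩ := sub_one_dvd_pow_sub_one w n
    rw [hc]
    exact (Commute.all _ _).isNilpotent_mul_right hw
  have h2 : IsUnit (Polynomial.aeval (1 : B) (Polynomial.derivative P)) := by
    have : Polynomial.aeval (1 : B) (Polynomial.derivative P) = algebraMap ℂ B n := by
      simp [P, Polynomial.derivative_X_pow, -map_pow]
    rw [this]
    exact (IsUnit.mk0 (n : ℂ) (by exact_mod_cast hn.ne')).map _
  exact (Polynomial.existsUnique_nilpotent_sub_and_aeval_eq_zero h1 h2).unique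
    ⟨by rw [← isNilpotent_neg_iff]; simpa using hu, by simp [P, h]⟩
    ⟨by rw [← isNilpotent_neg_iff]; simpa using hw, by simp [P]⟩

theorem aux_root_unique {R : Type*} [Ring R] [Algebra ℂ R] (n : ℕ) (hn : 0 < n) (u w : R)
    (hc : Commute u w) (hu : IsNilpotent (u - 1)) (hw : IsNilpotent (w - 1))
    (h : u ^ n = w ^ n) : u = w := by
  set B := Algebra.adjoin ℂ ({u, w} : Set R) with hB
  letI : CommRing B := Algebra.adjoinCommRingOfComm ℂ (by
    rintro _ (rfl | rfl) _ (rfl | rfl)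
    exacts [rfl, hc, hc.symm, rfl])
  let u' : B := ⟨u, Algebra.subset_adjoin (by simp)⟩
  let w' : B := ⟨w, Algebra.subset_adjoin (by simp)⟩
  have hu' : IsNilpotent (u' - 1) := by
    obtain ⟨r, hr⟩ := hu; exact ⟨r, Subtype.ext hr⟩
  have hw' : IsNilpotent (w' - 1) := by
    obtain ⟨r, hr⟩ := hw; exact ⟨r, Subtype.ext hr⟩
  have h' : u' ^ n = w' ^ n := Subtype.ext h
  have : u' = w' := aux_root_unique_comm (B := B) n hn u' w' hu' hw' h'
  exact congrArg Subtype.val this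

theorem aux_ps_root (n : ℕ) (hn : 0 < n) (p : PowerSeries ℂ)
    (hp : PowerSeries.constantCoeff p ≠ 0) : ∃ q : PowerSeries ℂ, q ^ n = p := by
  obtain ⟨c, hc⟩ := IsAlgClosed.exists_pow_nat_eq (PowerSeries.constantCoeff p) hn
  have hc0 : c ≠ 0 := by rintro rfl; rw [zero_pow hn.ne'] at hc; exact hp hc.symm
  have H : HenselianRing (PowerSeries ℂ) (Ideal.span {PowerSeries.X}) := inferInstance
  obtain ⟨q, hq, -⟩ := H.is_henselian (Polynomial.X ^ n - Polynomial.C p)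
    (Polynomial.monic_X_pow_sub_C p hn.ne') (PowerSeries.C c)
    (by
      rw [Ideal.mem_span_singleton, PowerSeries.X_dvd_iff]
      simp [hc])
    (by
      apply IsUnit.map
      rw [PowerSeries.isUnit_iff_constantCoeff]
      simp [Polynomial.derivative_X_pow, hc0, hn.ne'])
  exact ⟨q, by simpa [Polynomial.IsRoot, sub_eq_zero] using hq⟩

theorem aux_ls_root (n : ℕ) (hn : 0 < n) (f : LaurentSeries ℂ) (hf : f ≠ 0) :
    ∃ g : LaurentSeries ℂ, g ^ n = lsExpand n f := by
  have hn' : (n : ℤ) ≠ 0 := by exact_mod_cast hn.ne'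
  have hn0 : (0 : ℤ) < n := by exact_mod_cast hn
  let p : PowerSeries ℂ := PowerSeries.mk fun k => (lsExpand n f).coeff (f.order * n + k)
  have hp : PowerSeries.constantCoeff p ≠ 0 := by
    rw [← PowerSeries.coeff_zero_eq_constantCoeff_apply]
    simp only [p, PowerSeries.coeff_mk, lsExpand]
    simp only [Nat.cast_zero, add_zero, Int.mul_emod_left, if_true, Int.mul_ediv_cancel _ hn']
    exact fun h => hf (HahnSeries.coeff_order_eq_zero.1 h)
  obtain ⟨q, hq⟩ := aux_ps_root n hn p hp
  refine ⟨HahnSeries.single f.order 1 * HahnSeries.ofPowerSeries ℤ ℂ q, ?_⟩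
  rw [mul_pow, ← map_pow (HahnSeries.ofPowerSeries ℤ ℂ), hq, HahnSeries.single_pow]
  ext k
  rw [← sub_add_cancel k (n • f.order), HahnSeries.coeff_single_mul_add]
  simp only [one_pow, one_mul, sub_add_cancel]
  rcases le_or_gt (n • f.order) k with h | h
  · obtain ⟨j, hj⟩ := Int.eq_ofNat_of_zero_le (sub_nonneg.2 h)
    rw [hj, HahnSeries.ofPowerSeries_apply_coeff]
    simp only [p, PowerSeries.coeff_mk]
    congr 1
    simp only [nsmul_eq_mul] at hj
    linarith
  · have h1 : ((HahnSeries.ofPowerSeries ℤ ℂ) p).coeff (k - n • f.order) = 0 := by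
      rw [HahnSeries.ofPowerSeries_apply]
      apply HahnSeries.embDomain_notin_range
      rintro ⟨j, hj⟩
      simp at hj h
      omega
    rw [h1]
    simp only [lsExpand]
    split_ifs with h0
    · symm
      apply HahnSeries.coeff_eq_zero_of_lt_order
      apply Int.ediv_lt_of_lt_mul hn0
      simpa [mul_comm] using h
    · rfl

theorem aux_scalar_nil {A : Type*} [Ring A] [Algebra ℂ A] (s : Set A)
    (hs : ∀ a ∈ s, ∀ b ∈ s, a * b = b * a)
    (hn : ∀ a ∈ s, ∃ c : ℂ, IsNilpotent (a - c • (1 : A)))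
    (a : A) (ha : a ∈ Algebra.adjoin ℂ s) : ∃ c : ℂ, IsNilpotent (a - c • (1 : A)) := by
  have hcm : ∀ x ∈ Algebra.adjoin ℂ s, ∀ y ∈ Algebra.adjoin ℂ s, Commute x y := by
    intro x hx y hy
    refine Algebra.commute_of_mem_adjoin_of_forall_mem_commute hy fun b hb => ?_
    refine (Algebra.commute_of_mem_adjoin_of_forall_mem_commute hx fun c hc => ?_).symm
    exact hs b hb c hc
  have hone : ∀ (z : A) (c : ℂ), Commute z (c • (1 : A)) := fun z c =>
    (Commute.one_right z).smul_right c
  induction ha using Algebra.adjoin_induction with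
  | mem x hx => exact hn x hx
  | algebraMap r => exact ⟨r, by simp [Algebra.algebraMap_eq_smul_one]⟩
  | add x y hx hy ihx ihy =>
    obtain ⟨c, hc⟩ := ihx
    obtain ⟨d, hd⟩ := ihy
    refine ⟨c + d, ?_⟩
    have : x + y - (c + d) • (1 : A) = (x - c • (1 : A)) + (y - d • (1 : A)) := by
      rw [add_smul]; abel
    rw [this]
    refine Commute.isNilpotent_add ?_ hc hd
    exact ((hcm x hx y hy).sub_right (hone _ _)).sub_left
      ((hone _ _).symm)
  | mul x y hx hy ihx ihy =>
    obtain ⟨c, hc⟩ := ihx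
    obtain ⟨d, hd⟩ := ihy
    refine ⟨c * d, ?_⟩
    have : x * y - (c * d) • (1 : A) = (x - c • (1 : A)) * y + c • (y - d • (1 : A)) := by
      rw [sub_mul, smul_mul_assoc, one_mul, smul_sub, smul_smul]; abel
    rw [this]
    have hxy : Commute (x - c • (1 : A)) y := (hcm x hx y hy).sub_left (hone y c).symm
    refine Commute.isNilpotent_add ?_ (hxy.isNilpotent_mul_right hc) (hd.smul c)
    refine Commute.smul_right ?_ c
    refine Commute.sub_right ?_ (hone _ _)
    exact hxy.mul_left (Commute.refl y)

/-- Laurent series with all coefficients in a subalgebra. -/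
def auxSub {A : Type*} [Ring A] [Algebra ℂ A] (B : Subalgebra ℂ A) :
    Subalgebra ℂ (LaurentSeries A) where
  carrier := {T | ∀ k, T.coeff k ∈ B}
  mul_mem' := by
    intro x y hx hy k
    rw [HahnSeries.coeff_mul]
    exact sum_mem fun ij _ => mul_mem (hx _) (hy _)
  add_mem' := by
    intro x y hx hy k
    rw [HahnSeries.coeff_add]
    exact add_mem (hx _) (hy _)
  algebraMap_mem' := by
    intro r k
    rw [Algebra.algebraMap_eq_smul_one, HahnSeries.coeff_smul, HahnSeries.coeff_one]
    refine B.smul_mem ?_ r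
    split_ifs
    exacts [one_mem _, zero_mem _]

/-- Trace, normalised. -/
noncomputable def auxTr (m : ℕ) : Matrix (Fin m) (Fin m) ℂ →ₗ[ℂ] ℂ :=
  (m : ℂ)⁻¹ • Matrix.traceLinearMap (Fin m) ℂ ℂ

theorem auxTr_eq {m : ℕ} (hm : 0 < m) (a : Matrix (Fin m) (Fin m) ℂ) (c : ℂ)
    (h : IsNilpotent (a - c • (1 : Matrix (Fin m) (Fin m) ℂ))) : auxTr m a = c := by
  have h1 := (Matrix.isNilpotent_trace_of_isNilpotent h).eq_zero
  have hm' : (m : ℂ) ≠ 0 := by exact_mod_cast hm.ne'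
  rw [Matrix.trace_sub, Matrix.trace_smul, Matrix.trace_one, sub_eq_zero] at h1
  simp [auxTr, h1]
  field_simp

/-- Let `S ∈ Mₘ(ℂ)((x))` have pairwise commuting coefficients and be a
nonzero scalar series `f` plus coefficientwise-nilpotent terms.  Then the set of
`T ∈ Mₘ(ℂ)((y))` with pairwise commuting coefficients, equal to some scalar series
`g` plus coefficientwise-nilpotent terms, and with `Tⁿ = S(yⁿ)`, has exactly `n`
elements. -/
theorem stmt_15 (m n : ℕ) (hm : 0 < m) (hn : 0 < n)
    (S : LaurentSeries (Matrix (Fin m) (Fin m) ℂ))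
    (hcomm : ∀ i j : ℤ, Commute (S.coeff i) (S.coeff j))
    (f : LaurentSeries ℂ) (hf : f ≠ 0)
    (hnil : ∀ k : ℤ, IsNilpotent (S.coeff k - f.coeff k • (1 : Matrix (Fin m) (Fin m) ℂ))) :
    Set.ncard {T : LaurentSeries (Matrix (Fin m) (Fin m) ℂ) |
      (∀ i j : ℤ, Commute (T.coeff i) (T.coeff j)) ∧
      (∃ g : LaurentSeries ℂ,
        ∀ k : ℤ, IsNilpotent (T.coeff k - g.coeff k • (1 : Matrix (Fin m) (Fin m) ℂ))) ∧
      T ^ n = lsExpand n S} = n := by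
  have hn0 : (0 : ℤ) < n := by exact_mod_cast hn
  have : Nonempty (Fin m) := ⟨⟨0, hm⟩⟩
  set S' := lsExpand n S with hS'
  set f' := lsExpand n f with hf'
  have hSc : ∀ k, S'.coeff k = if k % (n : ℤ) = 0 then S.coeff (k / n) else 0 := fun _ => rfl
  have hfc : ∀ k, f'.coeff k = if k % (n : ℤ) = 0 then f.coeff (k / n) else 0 := fun _ => rfl
  have hf'0 : f' ≠ 0 := by
    intro h0
    apply hf
    ext k
    have := hfc (k * n)
    rw [h0, Int.mul_emod_left, if_pos rfl, Int.mul_ediv_cancel _ hn0.ne'] at this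
    exact this.symm
  have hScomm : ∀ i j, Commute (S'.coeff i) (S'.coeff j) := by
    intro i j
    rw [hSc, hSc]
    split_ifs
    exacts [hcomm _ _, Commute.zero_right _, Commute.zero_left _, Commute.zero_left _]
  have hSnil : ∀ k, IsNilpotent (S'.coeff k - f'.coeff k • (1 : Matrix (Fin m) (Fin m) ℂ)) := by
    intro k
    rw [hSc, hfc]
    split_ifs
    · exact hnil _
    · simp
  clear_value S' f'
  clear hSc hfc
  let φ : LaurentSeries ℂ →+* LaurentSeries (Matrix (Fin m) (Fin m) ℂ) :=
    auxMap (algebraMap ℂ (Matrix (Fin m) (Fin m) ℂ))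
  have hφc : ∀ g k, (φ g).coeff k = g.coeff k • (1 : Matrix (Fin m) (Fin m) ℂ) := by
    intro g k
    rw [← Algebra.algebraMap_eq_smul_one]; rfl
  have hφinj : Function.Injective φ := auxMap_injective _ (algebraMap ℂ _).injective
  have hφcomm : ∀ g T, Commute (φ g) T := by
    intro g T
    refine aux_commute _ _ fun i j => ?_
    exact Algebra.commutes _ _
  have hnilT : ∀ (T : LaurentSeries (Matrix (Fin m) (Fin m) ℂ)) (g : LaurentSeries ℂ),
      (∀ i j, Commute (T.coeff i) (T.coeff j)) →
      (∀ k, IsNilpotent (T.coeff k - g.coeff k • (1 : Matrix (Fin m) (Fin m) ℂ))) →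
      IsNilpotent (T - φ g) := by
    intro T g h1 h2
    have hone : ∀ (z : Matrix (Fin m) (Fin m) ℂ) (c : ℂ),
      Commute z (c • (1 : Matrix (Fin m) (Fin m) ℂ)) := fun z c =>
      (Commute.one_right z).smul_right c
    apply aux_nil
    · intro i j
      rw [HahnSeries.coeff_sub, HahnSeries.coeff_sub, hφc, hφc]
      exact ((h1 i j).sub_right (hone _ _)).sub_left ((hone _ _).symm)
    · intro k
      rw [HahnSeries.coeff_sub, hφc]
      exact h2 k
  have hN : IsNilpotent (S' - φ f') := hnilT _ _ hScomm hSnil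
  have hscale : ∀ (g : LaurentSeries ℂ) (T), g ≠ 0 → IsNilpotent (T - φ g) →
      IsNilpotent (φ g⁻¹ * T - 1) := by
    intro g T hg h
    have : φ g⁻¹ * T - 1 = φ g⁻¹ * (T - φ g) := by
      rw [mul_sub, ← map_mul, inv_mul_cancel₀ hg, map_one]
    rw [this]
    exact (hφcomm _ _).isNilpotent_mul_left h
  obtain ⟨w, hwmem, hwnil, hwn⟩ := aux_root_exists n hn (φ f'⁻¹ * S') (hscale f' S' hf'0 hN)
  have hwunit : IsUnit w := by
    have := hwnil.isUnit_add_one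
    simpa using this
  set B := Algebra.adjoin ℂ (Set.range S'.coeff) with hB
  have hBs : ∀ a ∈ Set.range S'.coeff, ∀ b ∈ Set.range S'.coeff, a * b = b * a := by
    rintro _ ⟨i, rfl⟩ _ ⟨j, rfl⟩
    exact hScomm i j
  have hφL : ∀ g, φ g ∈ auxSub B := by
    intro g k
    exact B.algebraMap_mem _
  have hSL : S' ∈ auxSub B := fun k => Algebra.subset_adjoin ⟨k, rfl⟩
  have hwL : w ∈ auxSub B := by
    refine (Algebra.adjoin_le ?_) hwmem
    rintro _ rfl
    exact mul_mem (hφL _) hSL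
  have hBcomm : ∀ x ∈ B, ∀ y ∈ B, Commute x y := by
    intro x hx y hy
    refine Algebra.commute_of_mem_adjoin_of_forall_mem_commute hy fun b hb => ?_
    refine (Algebra.commute_of_mem_adjoin_of_forall_mem_commute hx fun c hc => ?_).symm
    exact hBs b hb c hc
  have hset : {T : LaurentSeries (Matrix (Fin m) (Fin m) ℂ) |
      (∀ i j : ℤ, Commute (T.coeff i) (T.coeff j)) ∧
      (∃ g : LaurentSeries ℂ,
        ∀ k : ℤ, IsNilpotent (T.coeff k - g.coeff k • (1 : Matrix (Fin m) (Fin m) ℂ))) ∧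
      T ^ n = S'} = (fun g => φ g * w) '' (Polynomial.nthRootsFinset n f' : Set _) := by
    ext T
    simp only [Set.mem_setOf_eq, Set.mem_image, Finset.mem_coe,
      Polynomial.mem_nthRootsFinset hn]
    constructor
    · rintro ⟨h1, ⟨g, h2⟩, h3⟩
      have hM := hnilT T g h1 h2
      have hTS : Commute T S' := by rw [← h3]; exact Commute.self_pow T n
      have hgn : g ^ n = f' := by
        have hd : ∃ c, T ^ n - φ g ^ n = (T - φ g) * c ∧ Commute (T - φ g) c ∧ Commute S' c := by
          refine ⟨_, (Commute.mul_geom_sum₂ (hφcomm g T).symm n).symm, ?_, ?_⟩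
          · refine Commute.sum_right _ _ _ fun i _ => ?_
            refine Commute.mul_right ?_ ?_
            · exact ((Commute.refl T).sub_left (hφcomm g T)).pow_right _
            · exact (hφcomm g _).symm.pow_right _
          · refine Commute.sum_right _ _ _ fun i _ => ?_
            refine Commute.mul_right ?_ ?_
            · exact hTS.symm.pow_right _
            · exact (hφcomm g _).symm.pow_right _
        obtain ⟨c, hc1, hc2, hc3⟩ := hd
        have h4 : IsNilpotent (S' - φ (g ^ n)) := by
          rw [map_pow, ← h3, hc1]
          exact hc2.isNilpotent_mul_right hM
        have h5 : IsNilpotent (φ (f' - g ^ n)) := by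
          have : φ (f' - g ^ n) = (S' - φ (g ^ n)) - (S' - φ f') := by
            rw [map_sub]; abel
          rw [this]
          refine Commute.isNilpotent_sub ?_ h4 hN
          refine Commute.sub_left ?_ (hφcomm _ _)
          exact Commute.sub_right (Commute.refl _) (hφcomm _ _).symm
        have h6 : IsNilpotent (f' - g ^ n) := (IsNilpotent.map_iff hφinj).1 h5
        exact (sub_eq_zero.1 h6.eq_zero).symm
      have hg0 : g ≠ 0 := by
        rintro rfl
        rw [zero_pow hn.ne'] at hgn
        exact hf'0 hgn.symm
      refine ⟨g, hgn, ?_⟩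
      have hun : (φ g⁻¹ * T) ^ n = φ f'⁻¹ * S' := by
        rw [(hφcomm _ _).mul_pow, h3, ← map_pow, inv_pow, hgn]
      have huw : φ g⁻¹ * T = w := by
        refine aux_root_unique n hn _ _ ?_ (hscale g T hg0 hM) hwnil (hun.trans hwn.symm)
        refine Algebra.commute_of_mem_adjoin_singleton_of_commute hwmem ?_
        rw [← hun]
        exact Commute.self_pow _ _
      show φ g * w = T
      rw [← huw, ← mul_assoc, ← map_mul, mul_inv_cancel₀ hg0, map_one, one_mul]
    · rintro ⟨g, hgn, rfl⟩
      have hT : φ g * w ∈ auxSub B := mul_mem (hφL g) hwL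
      refine ⟨fun i j => hBcomm _ (hT i) _ (hT j), ⟨HahnSeries.map (φ g * w) (auxTr m), ?_⟩, ?_⟩
      · intro k
        obtain ⟨c, hc⟩ := aux_scalar_nil _ hBs (by
          rintro _ ⟨k, rfl⟩; exact ⟨_, hSnil k⟩) _ (hT k)
        have : (HahnSeries.map (φ g * w) (auxTr m)).coeff k = c := auxTr_eq hm _ _ hc
        rw [this]
        exact hc
      · rw [(hφcomm _ _).mul_pow, hwn, ← map_pow, hgn, ← mul_assoc, ← map_mul,
          mul_inv_cancel₀ hf'0, map_one, one_mul]
  rw [hset, Set.ncard_image_of_injective, Set.ncard_coe_finset]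
  · have hζ : IsPrimitiveRoot (HahnSeries.C (Complex.exp (2 * Real.pi * Complex.I / n)) :
        LaurentSeries ℂ) n :=
      (Complex.isPrimitiveRoot_exp n hn.ne').map_of_injective
        (f := (HahnSeries.C : ℂ →+* LaurentSeries ℂ)) HahnSeries.C_injective
    classical
    rw [Polynomial.nthRootsFinset_def, Multiset.toFinset_card_of_nodup (hζ.nthRoots_nodup hf'0),
      hζ.card_nthRoots, if_pos]
    rw [hf']
    exact aux_ls_root n hn f hf
  · intro g g' h
    exact hφinj (hwunit.mul_left_injective h)
end
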